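/- Let |ĩ⟩ : Fin K → (E × Ē → ℂ) be an orthonormal family, let O act within the code subspace with logical matrix L, and let φ : (Fin K × E) × Ē → ℂ be the reference state φ((i,m),a) = K^{-1/2}·ĩ(m,a), with reduced density matrix ρ_RE[φ] on Fin K × E. Then the condition that ⟨ĩ| [O, X_E ⊗ I_Ē] |j̃⟩ = 0 for every operator X_E on (E → ℂ) and all i,j holds if and only if the matrix Lᵀ ⊗ I_E (Kronecker product of the transpose of the logical matrix with the identity on E) commutes with ρ_RE[φ]. -/

import Mathlib

open scoped ComplexConjugate Matrix Kronecker

/-- Inner product `⟨v,w⟩ = Σ conj(v)·w` on a finite-dimensional Hilbert space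
modeled as functions to `ℂ`. -/
noncomputable def ip {ι : Type*} [Fintype ι] (v w : ι → ℂ) : ℂ :=
  ∑ x, conj (v x) * w x

/-- The action of an operator `X` on the `E` factor of the tensor product,
i.e. `X ⊗ I_Ebar`. -/
noncomputable def actE {E Ebar : Type*} [Fintype E] (X : Matrix E E ℂ)
    (v : E × Ebar → ℂ) : E × Ebar → ℂ :=
  fun p => ∑ m', X p.1 m' * v (m', p.2)

/-- The action of an operator `Y` on the `Ebar` factor of the tensor product,
i.e. `I_E ⊗ Y`. -/
noncomputable def actEbar {E Ebar : Type*} [Fintype Ebar] (Y : Matrix Ebar Ebar ℂ)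
    (v : E × Ebar → ℂ) : E × Ebar → ℂ :=
  fun p => ∑ a', Y p.2 a' * v (p.1, a')

/-- The reference state `φ((i,m),a) = K^{-1/2}·ĩ(m,a)` obtained by entangling
the code subspace with a reference system `R = Fin K`. -/
noncomputable def refState {E Ebar : Type*} {K : ℕ} (ti : Fin K → (E × Ebar → ℂ)) :
    (Fin K × E) × Ebar → ℂ :=
  fun x => ((Real.sqrt K : ℝ) : ℂ)⁻¹ * ti x.1.1 (x.1.2, x.2)

/-- The reduced density matrix `ρ_RE[φ]` of the reference state on `R × E`. -/
noncomputable def rhoRE {E Ebar : Type*} [Fintype Ebar] {K : ℕ}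
    (ti : Fin K → (E × Ebar → ℂ)) : Matrix (Fin K × E) (Fin K × E) ℂ :=
  Matrix.of fun p q => ∑ a, refState ti (p, a) * conj (refState ti (q, a))

/-- The reduced density matrix `ρ_R[φ]` of the reference state on `R`. -/
noncomputable def rhoR {E Ebar : Type*} [Fintype E] [Fintype Ebar] {K : ℕ}
    (ti : Fin K → (E × Ebar → ℂ)) : Matrix (Fin K) (Fin K) ℂ :=
  Matrix.of fun i j => ∑ m, ∑ a, refState ti ((i, m), a) * conj (refState ti ((j, m), a))

/-- The reduced density matrix `ρ_E[φ]` of the reference state on `E`. -/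
noncomputable def rhoE {E Ebar : Type*} [Fintype Ebar] {K : ℕ}
    (ti : Fin K → (E × Ebar → ℂ)) : Matrix E E ℂ :=
  Matrix.of fun m n => ∑ i, ∑ a, refState ti ((i, m), a) * conj (refState ti ((i, n), a))

theorem aux_ip_adj {ι : Type*} [Fintype ι] (O : Matrix ι ι ℂ) (v w : ι → ℂ) :
    ip v (O.mulVec w) = ip ((Oᴴ).mulVec v) w := by
  simp only [ip, Matrix.mulVec, dotProduct, Matrix.conjTranspose_apply, map_sum, map_mul,
    Finset.mul_sum, Finset.sum_mul]
  rw [Finset.sum_comm]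
  refine Finset.sum_congr rfl fun x _ => Finset.sum_congr rfl fun y _ => ?_
  simp
  ring

theorem aux_ip_sum_left {ι κ : Type*} [Fintype ι] [Fintype κ] (c : κ → ℂ) (f : κ → ι → ℂ)
    (w : ι → ℂ) : ip (∑ j, conj (c j) • f j) w = ∑ j, c j * ip (f j) w := by
  simp only [ip, Finset.sum_apply, Pi.smul_apply, smul_eq_mul, map_sum, map_mul,
    Finset.mul_sum, Finset.sum_mul, Complex.conj_conj]
  rw [Finset.sum_comm]
  simp only [mul_assoc]

theorem aux_ip_sum_right {E Ebar κ : Type*} [Fintype E] [Fintype Ebar] [Fintype κ]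
    (X : Matrix E E ℂ) (c : κ → ℂ) (f : κ → E × Ebar → ℂ)
    (v : E × Ebar → ℂ) :
    ip v (actE X (∑ j, c j • f j)) = ∑ j, c j * ip v (actE X (f j)) := by
  have : actE X (∑ j, c j • f j) = ∑ j, c j • actE X (f j) := by
    funext p
    simp only [actE, Finset.sum_apply, Pi.smul_apply, smul_eq_mul, Finset.mul_sum]
    rw [Finset.sum_comm]
    refine Finset.sum_congr rfl fun x _ => Finset.sum_congr rfl fun y _ => ?_
    ring
  rw [this]
  simp only [ip, Finset.sum_apply, Pi.smul_apply, smul_eq_mul, Finset.mul_sum]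
  rw [Finset.sum_comm]
  refine Finset.sum_congr rfl fun x _ => Finset.sum_congr rfl fun y _ => ?_
  ring

/-- Unnormalised reduced matrix. -/
noncomputable def auxG {E Ebar : Type*} [Fintype Ebar] {K : ℕ}
    (ti : Fin K → (E × Ebar → ℂ)) (i j : Fin K) (m n : E) : ℂ :=
  ∑ a, ti i (m, a) * conj (ti j (n, a))

theorem aux_ip_actE {E Ebar : Type*} [Fintype E] [Fintype Ebar] {K : ℕ}
    (ti : Fin K → (E × Ebar → ℂ)) (X : Matrix E E ℂ) (i j : Fin K) :
    ip (ti i) (actE X (ti j)) = ∑ m, ∑ n, X m n * auxG ti j i n m := by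
  simp only [ip, actE, auxG, Fintype.sum_prod_type, Finset.mul_sum]
  refine Finset.sum_congr rfl fun m _ => ?_
  rw [Finset.sum_comm]
  refine Finset.sum_congr rfl fun x _ => Finset.sum_congr rfl fun y _ => ?_
  ring

theorem aux_rho {E Ebar : Type*} [Fintype Ebar] {K : ℕ}
    (ti : Fin K → (E × Ebar → ℂ)) (i j : Fin K) (m n : E) :
    rhoRE ti (i, m) (j, n) = (K : ℂ)⁻¹ * auxG ti i j m n := by
  have h : ((Real.sqrt K : ℝ) : ℂ)⁻¹ * ((Real.sqrt K : ℝ) : ℂ)⁻¹ = (K : ℂ)⁻¹ := by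
    rw [← mul_inv, ← Complex.ofReal_mul, Real.mul_self_sqrt (Nat.cast_nonneg K)]
    simp
  simp only [rhoRE, refState, auxG, Matrix.of_apply, ← h, Finset.mul_sum, map_mul, map_inv₀,
    Complex.conj_ofReal]
  refine Finset.sum_congr rfl fun x _ => ?_
  ring

theorem aux_comm {E Ebar : Type*} [Fintype E] [Fintype Ebar] [DecidableEq E] {K : ℕ}
    (ti : Fin K → (E × Ebar → ℂ)) (L : Matrix (Fin K) (Fin K) ℂ) :
    (Lᵀ ⊗ₖ (1 : Matrix E E ℂ)) * rhoRE ti = rhoRE ti * (Lᵀ ⊗ₖ (1 : Matrix E E ℂ)) ↔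
    ∀ i j m n, ∑ k, L i k * auxG ti j k n m = ∑ k, L k j * auxG ti k i n m := by
  have key : ∀ i j m n,
      (((Lᵀ ⊗ₖ (1 : Matrix E E ℂ)) * rhoRE ti) (j, n) (i, m) =
        (K : ℂ)⁻¹ * ∑ k, L k j * auxG ti k i n m) ∧
      ((rhoRE ti * (Lᵀ ⊗ₖ (1 : Matrix E E ℂ))) (j, n) (i, m) =
        (K : ℂ)⁻¹ * ∑ k, L i k * auxG ti j k n m) := by
    intro i j m n
    constructor
    · simp only [Matrix.mul_apply, Fintype.sum_prod_type, Matrix.kroneckerMap_apply, aux_rho,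
        Matrix.one_apply, Matrix.transpose_apply, Finset.mul_sum, mul_ite, ite_mul, mul_one,
        mul_zero, zero_mul, Finset.sum_ite_eq, Finset.mem_univ, if_true]
      refine Finset.sum_congr rfl fun x _ => ?_
      ring
    · simp only [Matrix.mul_apply, Fintype.sum_prod_type, Matrix.kroneckerMap_apply, aux_rho,
        Matrix.one_apply, Matrix.transpose_apply, Finset.mul_sum, mul_ite, ite_mul, mul_one,
        mul_zero, zero_mul, Finset.sum_ite_eq', Finset.mem_univ, if_true]
      refine Finset.sum_congr rfl fun x _ => ?_
      ring
  constructor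
  · intro h i j m n
    have h1 := congrFun (congrFun h (j, n)) (i, m)
    rw [(key i j m n).1, (key i j m n).2] at h1
    have hK : (K : ℂ)⁻¹ ≠ 0 := inv_ne_zero (Nat.cast_ne_zero.2 (Fin.pos i).ne')
    exact (mul_left_cancel₀ hK h1).symm
  · intro h
    ext ⟨j, n⟩ ⟨i, m⟩
    rw [(key i j m n).1, (key i j m n).2, h]

/-- The commutator condition `⟨ĩ|[O, X_E ⊗ I_Ebar]|j̃⟩ = 0` for all operators
`X_E` on `E` holds if and only if `Lᵀ ⊗ I_E` commutes with the reduced density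
matrix `ρ_RE[φ]` of the reference state. -/
theorem commutator_condition_iff_commutes_with_rhoRE
    {E Ebar : Type*} [Fintype E] [Fintype Ebar] [Nonempty E] [Nonempty Ebar]
    [DecidableEq E] {K : ℕ}
    (ti : Fin K → (E × Ebar → ℂ))
    (horth : ∀ i j, ip (ti i) (ti j) = if i = j then 1 else 0)
    (O : Matrix (E × Ebar) (E × Ebar) ℂ) (L : Matrix (Fin K) (Fin K) ℂ)
    (hO : ∀ i, O.mulVec (ti i) = ∑ j, L j i • ti j)
    (hOd : ∀ i, (Oᴴ).mulVec (ti i) = ∑ j, conj (L i j) • ti j) :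
    (∀ (X : Matrix E E ℂ) (i j : Fin K),
        ip (ti i) (O.mulVec (actE X (ti j))) -
            ip (ti i) (actE X (O.mulVec (ti j))) = 0) ↔
      (Lᵀ ⊗ₖ (1 : Matrix E E ℂ)) * rhoRE ti = rhoRE ti * (Lᵀ ⊗ₖ (1 : Matrix E E ℂ)) := by
  rw [aux_comm]
  have e : ∀ (X : Matrix E E ℂ) (i j : Fin K),
      ip (ti i) (O.mulVec (actE X (ti j))) - ip (ti i) (actE X (O.mulVec (ti j))) =
      ∑ m, ∑ n, X m n *
        (∑ k, L i k * auxG ti j k n m - ∑ k, L k j * auxG ti k i n m) := by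
    intro X i j
    rw [aux_ip_adj, hOd, hO, aux_ip_sum_left, aux_ip_sum_right]
    simp only [aux_ip_actE, mul_sub, Finset.sum_sub_distrib, Finset.mul_sum]
    congr 1
    · rw [Finset.sum_comm]
      refine Finset.sum_congr rfl fun m _ => ?_
      rw [Finset.sum_comm]
      refine Finset.sum_congr rfl fun x _ => Finset.sum_congr rfl fun y _ => ?_
      ring
    · rw [Finset.sum_comm]
      refine Finset.sum_congr rfl fun m _ => ?_
      rw [Finset.sum_comm]
      refine Finset.sum_congr rfl fun x _ => Finset.sum_congr rfl fun y _ => ?_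
      ring
  simp only [e]
  constructor
  · intro h i j m n
    have h1 := h (Matrix.of fun a b => if m = a then (if n = b then 1 else 0) else 0) i j
    simp only [Matrix.of_apply, ite_mul, one_mul, zero_mul, Finset.sum_ite_irrel,
      Finset.sum_ite_eq, Finset.mem_univ, if_true, Finset.sum_const_zero] at h1
    exact sub_eq_zero.1 h1
  · intro h X i j
    simp [h]
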